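/- For every maximal consistent set X (relative to 𝒜_PCL), the relation ≤_X on formulas is reflexive and transitive. -/

import Mathlib

/-- Formulas of conditional logic. -/
inductive Formula : Type
  | atom : ℕ → Formula
  | bot : Formula
  | and : Formula → Formula → Formula
  | or : Formula → Formula → Formula
  | imp : Formula → Formula → Formula
  | cond : Formula → Formula → Formula

namespace Formula

/-- ¬A abbreviates A → ⊥. -/
def neg (A : Formula) : Formula := A.imp Formula.bot

/-- ⊤ abbreviates ⊥ → ⊥. -/
def top : Formula := Formula.bot.imp Formula.bot

/-- A ↔ B abbreviates (A → B) ∧ (B → A). -/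
def biimp (A B : Formula) : Formula := (A.imp B).and (B.imp A)

/-- Boolean evaluation of a formula, where atoms are evaluated via `v` and
conditional subformulas are treated as atoms evaluated via `w`. -/
def beval (v : ℕ → Bool) (w : Formula → Formula → Bool) : Formula → Bool
  | atom p => v p
  | bot => false
  | and A B => beval v w A && beval v w B
  | or A B => beval v w A || beval v w B
  | imp A B => !(beval v w A) || beval v w B
  | cond A B => w A B

/-- Classical propositional tautology (conditional subformulas treated as atoms). -/
def Tautology (F : Formula) : Prop := ∀ v w, beval v w F = true

end Formula

open Formula

/-- Hilbert-style derivability: classical tautologies, modus ponens,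
(RCEA), (RCK), (ID), (R-And), (CM), (OR), plus extra axioms from `Ax`. -/
inductive Deriv (Ax : Set Formula) : Formula → Prop
  | taut {F : Formula} : Tautology F → Deriv Ax F
  | extra {F : Formula} : F ∈ Ax → Deriv Ax F
  | mp {A B : Formula} : Deriv Ax (A.imp B) → Deriv Ax A → Deriv Ax B
  | rcea {A B C : Formula} : Deriv Ax (A.biimp B) →
      Deriv Ax ((A.cond C).biimp (B.cond C))
  | rck {A B C : Formula} : Deriv Ax (A.imp B) → Deriv Ax ((C.cond A).imp (C.cond B))
  | id {A : Formula} : Deriv Ax (A.cond A)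
  | rAnd {A B C : Formula} : Deriv Ax (((A.cond B).and (A.cond C)).imp (A.cond (B.and C)))
  | cm {A B C : Formula} : Deriv Ax (((A.cond B).and (A.cond C)).imp ((A.and B).cond C))
  | or {A B C : Formula} : Deriv Ax (((A.cond C).and (B.cond C)).imp ((A.or B).cond C))

/-- Derivability in the basic preferential conditional logic PCL. -/
def PCL : Formula → Prop := Deriv ∅

/-- Forcing of a formula at a world, for raw neighbourhood data. -/
def Force {W : Type} (N : W → Set (Set W)) (val : ℕ → Set W) : Formula → W → Prop
  | Formula.atom p, x => x ∈ val p
  | Formula.bot, _ => False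
  | Formula.and A B, x => Force N val A x ∧ Force N val B x
  | Formula.or A B, x => Force N val A x ∨ Force N val B x
  | Formula.imp A B, x => Force N val A x → Force N val B x
  | Formula.cond A B, x => ∀ α ∈ N x, (∃ y ∈ α, Force N val A y) →
      ∃ β ∈ N x, β ⊆ α ∧ (∃ y ∈ β, Force N val A y) ∧
        ∀ y ∈ β, (Force N val A y → Force N val B y)

/-- A neighbourhood model. -/
structure NbhdModel where
  W : Type
  wNonempty : Nonempty W
  N : W → Set (Set W)
  val : ℕ → Set W
  nbhdNonempty : ∀ x : W, ∀ α ∈ N x, α.Nonempty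

/-- Forcing in a neighbourhood model. -/
def NbhdModel.force (M : NbhdModel) : Formula → M.W → Prop := Force M.N M.val

/-- Validity in the class of all neighbourhood models. -/
def ValidAll (F : Formula) : Prop := ∀ (M : NbhdModel) (x : M.W), M.force F x

/-- Total reflexivity. -/
def NbhdModel.TotallyReflexive (M : NbhdModel) : Prop :=
  ∀ x : M.W, ∃ α ∈ M.N x, x ∈ α

/-- Weak centering. -/
def NbhdModel.WeaklyCentered (M : NbhdModel) : Prop :=
  ∀ x : M.W, ∀ α ∈ M.N x, x ∈ α

/-- Centering. -/
def NbhdModel.Centered (M : NbhdModel) : Prop :=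
  (∀ x : M.W, ∀ α ∈ M.N x, x ∈ α) ∧ ∀ x : M.W, {x} ∈ M.N x

/-- Uniformity. -/
def NbhdModel.Uniform (M : NbhdModel) : Prop :=
  ∀ x y : M.W, (∃ α ∈ M.N x, y ∈ α) → ⋃₀ M.N x = ⋃₀ M.N y

/-- Absoluteness. -/
def NbhdModel.Absolute (M : NbhdModel) : Prop :=
  ∀ x y : M.W, ∀ α ∈ M.N x, y ∈ α → M.N x = M.N y

/-- Conjunction of a list of formulas. -/
def conj : List Formula → Formula
  | [] => Formula.top
  | A :: l => A.and (conj l)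

/-- A set of formulas is inconsistent if some nonempty finite list of its members
has a PCL-provably contradictory conjunction. -/
def Inconsistent (S : Set Formula) : Prop :=
  ∃ L : List Formula, L ≠ [] ∧ (∀ B ∈ L, B ∈ S) ∧ PCL ((conj L).imp Formula.bot)

def Consistent (S : Set Formula) : Prop := ¬ Inconsistent S

/-- Maximal consistent set. -/
def MaxConsistent (S : Set Formula) : Prop :=
  Consistent S ∧ ∀ A ∉ S, Inconsistent (insert A S)

/-- Set of conditional consequences X^B = {C : B > C ∈ X}. -/
def condCons (X : Set Formula) (B : Formula) : Set Formula := {C | B.cond C ∈ X}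

/-- A ≤_X B iff (A ∨ B) > A ∈ X. -/
def cleq (X : Set Formula) (A B : Formula) : Prop := (A.or B).cond A ∈ X

/-- Worlds of the canonical model: pairs (X, A) with X maximal consistent, A ∈ X. -/
def CanonWorld : Type :=
  {p : Set Formula × Formula // MaxConsistent p.1 ∧ p.2 ∈ p.1}

/-- Canonical neighbourhood α^X_{(Y,B)}. -/
def sphere (X : Set Formula) (Y : CanonWorld) : Set CanonWorld :=
  {Z | condCons X Z.val.2 ⊆ Z.val.1 ∧ cleq X Z.val.2 Y.val.2 ∧ Y.val.2 ∉ Z.val.1}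
    ∪ {Y}

/-- Canonical neighbourhood function 𝒩(X,A). -/
def canonN (x : CanonWorld) : Set (Set CanonWorld) :=
  {α | ∃ Y : CanonWorld, condCons x.val.1 Y.val.2 ⊆ Y.val.1 ∧ α = sphere x.val.1 Y}

/-- Canonical valuation. -/
def canonVal (p : ℕ) : Set CanonWorld := {w | Formula.atom p ∈ w.val.1}

/-- Axiom (N). -/
def axN : Formula := (Formula.top.cond Formula.bot).neg
/-- Axiom schema (T). -/
def axT : Set Formula := {F | ∃ A : Formula, F = A.imp (A.cond Formula.bot).neg}
/-- Axiom schema (W). -/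
def axW : Set Formula := {F | ∃ A B : Formula, F = (A.cond B).imp (A.imp B)}
/-- Axiom schema (C). -/
def axC : Set Formula := {F | ∃ A B : Formula, F = (A.and B).imp (A.cond B)}
/-- Axiom schema (U1). -/
def axU1 : Set Formula :=
  {F | ∃ A : Formula,
    F = (A.neg.cond Formula.bot).imp ((A.neg.cond Formula.bot).neg.cond Formula.bot)}
/-- Axiom schema (U2). -/
def axU2 : Set Formula :=
  {F | ∃ A : Formula,
    F = (A.cond Formula.bot).neg.imp ((A.cond Formula.bot).cond Formula.bot)}

theorem beval_conj (v : ℕ → Bool) (w : Formula → Formula → Bool) (L : List Formula) :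
    beval v w (conj L) = true ↔ ∀ B ∈ L, beval v w B = true := by
  induction L with
  | nil => simp [conj, beval, Formula.top]
  | cons a l ih => simp [conj, beval, ih]

theorem pcl_sound {F : Formula} (h : PCL F) :
    beval (fun _ => true) (fun _ _ => true) F = true := by
  unfold PCL at h
  induction h with
  | taut h => exact h _ _
  | extra h => exact absurd h (Set.notMem_empty _)
  | mp _ _ h1 h2 => simpa [beval, h2] using h1
  | _ => simp [beval, biimp]

theorem mc_nonempty {X : Set Formula} (hX : MaxConsistent X) : ∃ A, A ∈ X := by
  by_contra hne
  push Not at hne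
  obtain ⟨L, _, hL, hd⟩ := hX.2 Formula.top (hne _)
  have hs := pcl_sound hd
  have hc : beval (fun _ => true) (fun _ _ => true) (conj L) = true := by
    rw [beval_conj]
    intro B hB
    rcases hL B hB with h | h
    · subst h; rfl
    · exact absurd h (hne B)
  simp [beval, hc] at hs

theorem mc_closed {X : Set Formula} (hX : MaxConsistent X) {A B F : Formula}
    (hA : A ∈ X) (hB : B ∈ X) (h : PCL ((A.and B).imp F)) : F ∈ X := by
  classical
  by_contra hF
  obtain ⟨L, _, hL, hd⟩ := hX.2 F hF
  refine hX.1 ⟨A :: B :: L.filter (fun G => G ≠ F), by simp, ?_, ?_⟩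
  · intro G hG
    simp only [List.mem_cons, List.mem_filter, decide_eq_true_eq] at hG
    rcases hG with rfl | rfl | ⟨h1, h2⟩
    · exact hA
    · exact hB
    · exact (hL G h1).resolve_left h2
  · refine Deriv.mp (Deriv.mp (Deriv.taut ?_) h) hd
    intro v w
    have key : beval v w A = true → beval v w B = true → beval v w F = true →
        beval v w (conj (L.filter (fun G => G ≠ F))) = true →
        beval v w (conj L) = true := by
      intro _ _ hf hc
      rw [beval_conj] at hc ⊢
      intro G hG
      by_cases hGF : G = F
      · rw [hGF]; exact hf
      · exact hc G (by simp [hG, hGF])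
    simp only [conj, beval]
    revert key
    generalize beval v w (conj (L.filter (fun G => G ≠ F))) = c
    generalize beval v w (conj L) = d
    generalize beval v w A = a
    generalize beval v w B = b
    generalize beval v w F = f
    revert a b c d f
    decide

theorem mc_closed1 {X : Set Formula} (hX : MaxConsistent X) {A F : Formula}
    (hA : A ∈ X) (h : PCL (A.imp F)) : F ∈ X := by
  refine mc_closed hX hA hA (Deriv.mp (Deriv.taut ?_) h)
  intro v w
  simp only [beval]
  cases beval v w A <;> cases beval v w F <;> rfl

theorem mc_thm {X : Set Formula} (hX : MaxConsistent X) {F : Formula}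
    (h : PCL F) : F ∈ X := by
  obtain ⟨A, hA⟩ := mc_nonempty hX
  refine mc_closed1 hX hA (Deriv.mp (Deriv.taut ?_) h)
  intro v w
  simp only [beval]
  cases beval v w A <;> cases beval v w F <;> rfl

theorem mc_rck {X : Set Formula} (hX : MaxConsistent X) {A B C : Formula}
    (h : C.cond A ∈ X) (ht : Tautology (A.imp B)) : C.cond B ∈ X :=
  mc_closed1 hX h (Deriv.rck (Deriv.taut ht))

theorem mc_rcea {X : Set Formula} (hX : MaxConsistent X) {A B C : Formula}
    (h : A.cond C ∈ X) (ht : Tautology (A.biimp B)) : B.cond C ∈ X := by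
  refine mc_closed1 hX h (Deriv.mp (Deriv.taut ?_) (Deriv.rcea (C := C) (Deriv.taut ht)))
  intro v w
  simp only [beval, biimp]
  cases w A C <;> cases w B C <;> rfl

theorem mc_id {X : Set Formula} (hX : MaxConsistent X) {A B : Formula}
    (ht : Tautology (A.imp B)) : A.cond B ∈ X :=
  mc_rck hX (mc_thm hX Deriv.id) ht

/-- ≤_X is reflexive and transitive for every maximal consistent X. -/
theorem cleq_refl_trans (X : Set Formula) (hX : MaxConsistent X) :
    (∀ A : Formula, cleq X A A) ∧
      (∀ A B C : Formula, cleq X A B → cleq X B C → cleq X A C) := by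
  refine ⟨fun A => mc_id hX ?_, fun A B C hAB hBC => ?_⟩
  · intro v w
    simp only [beval]
    cases beval v w A <;> rfl
  · unfold cleq at *
    -- D = A ∨ (B ∨ C)
    have h1 : (A.or (B.or C)).cond (A.or B) ∈ X := by
      refine mc_closed hX (mc_id hX ?_) (mc_rck hX hBC ?_) Deriv.or
      all_goals
        intro v w
        simp only [beval]
        cases beval v w A <;> cases beval v w B <;> rfl
    have h2 : ((A.or B).or (C.and (A.or B).neg)).cond ((A.or B).imp A) ∈ X := by
      refine mc_closed hX (mc_rck hX hAB ?_) (mc_id hX ?_) Deriv.or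
      all_goals
        intro v w
        simp only [beval, neg]
        cases beval v w A <;> cases beval v w B <;> cases beval v w C <;> rfl
    have h3 : (A.or (B.or C)).cond ((A.or B).imp A) ∈ X := by
      refine mc_rcea hX h2 ?_
      intro v w
      simp only [beval, neg, biimp]
      cases beval v w A <;> cases beval v w B <;> cases beval v w C <;> rfl
    have h4 : (A.or (B.or C)).cond A ∈ X := by
      refine mc_rck hX (mc_closed hX h1 h3 Deriv.rAnd) ?_
      intro v w
      simp only [beval]
      cases beval v w A <;> cases beval v w B <;> rfl
    have h5 : (A.or (B.or C)).cond (A.or C) ∈ X := by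
      refine mc_rck hX h4 ?_
      intro v w
      simp only [beval]
      cases beval v w A <;> cases beval v w C <;> rfl
    refine mc_rcea hX (mc_closed hX h5 h4 Deriv.cm) ?_
    intro v w
    simp only [beval, biimp]
    cases beval v w A <;> cases beval v w B <;> cases beval v w C <;> rfl
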